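/- The graph G does not admit a planar geometric storyplan. -/

import Mathlib

/-- The straight-line drawing `D` of the subgraph of `G` induced by the visible
vertex set `S` is planar. -/
def IsPlanarSLFrame {V : Type*} (G : SimpleGraph V) (S : Set V) (D : V → ℝ × ℝ) : Prop :=
  Set.InjOn D S ∧
  (∀ u v w, G.Adj u v → u ∈ S → v ∈ S → w ∈ S → w ≠ u → w ≠ v →
      D w ∉ openSegment ℝ (D u) (D v)) ∧
  (∀ u v x y, G.Adj u v → G.Adj x y → u ∈ S → v ∈ S → x ∈ S → y ∈ S →
      ¬((u = x ∧ v = y) ∨ (u = y ∧ v = x)) →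
      ∀ p ∈ segment ℝ (D u) (D v) ∩ segment ℝ (D x) (D y),
        ∃ z, (z = u ∨ z = v) ∧ (z = x ∨ z = y) ∧ p = D z)

/-- `(len, s, e, D)` is a planar geometric storyplan of `G`: `len ≥ 1` time steps,
each vertex `v` is visible on the nonempty interval `[s v, e v] ⊆ [1, len]`,
the endpoints of every edge co-occur, and every frame is a planar
straight-line drawing. -/
def IsGeomStoryplan {V : Type*} (G : SimpleGraph V)
    (len : ℕ) (s e : V → ℕ) (D : V → ℝ × ℝ) : Prop :=
  1 ≤ len ∧
  (∀ v, 1 ≤ s v ∧ s v ≤ e v ∧ e v ≤ len) ∧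
  (∀ u v, G.Adj u v → ∃ t, s u ≤ t ∧ t ≤ e u ∧ s v ≤ t ∧ t ≤ e v) ∧
  (∀ t, 1 ≤ t → t ≤ len → IsPlanarSLFrame G {v | s v ≤ t ∧ t ≤ e v} D)

/-- `G` admits a planar geometric storyplan. -/
def HasGeomStoryplan {V : Type*} (G : SimpleGraph V) : Prop :=
  ∃ len s e D, IsGeomStoryplan G len s e D

/-- The 28 vertices of the graph `G`: cycle vertices `a i`, `b i`, `c i`
(`i ∈ Fin 4`), apex vertices `q i j` and edge vertices `r i j`
(`i ∈ Fin 4`, `j ∈ Fin 2`). -/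
inductive GVert : Type
  | a : Fin 4 → GVert
  | b : Fin 4 → GVert
  | c : Fin 4 → GVert
  | q : Fin 4 → Fin 2 → GVert
  | r : Fin 4 → Fin 2 → GVert
  deriving DecidableEq

/-- Base relation generating the edges of `G`: the three 4-cycles
`A`, `B`, `C`; each apex vertex `q i j` adjacent to all twelve cycle vertices;
each edge vertex `r i j` adjacent to `q i j` and to the six cycle vertices
`a i, a (i+1), b i, b (i+1), c i, c (i+1)`. -/
def GRel : GVert → GVert → Prop
  | .a i, .a k => k = i + 1
  | .b i, .b k => k = i + 1
  | .c i, .c k => k = i + 1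
  | .q _ _, .a _ => True
  | .q _ _, .b _ => True
  | .q _ _, .c _ => True
  | .r i j, .q i' j' => i' = i ∧ j' = j
  | .r i _, .a k => k = i ∨ k = i + 1
  | .r i _, .b k => k = i ∨ k = i + 1
  | .r i _, .c k => k = i ∨ k = i + 1
  | _, _ => False

/-- The graph `G` from the paper (28 vertices). -/
def GraphG : SimpleGraph GVert := SimpleGraph.fromRel GRel
/-! Planar geometry by signed areas -/

/-- Signed double area of the triangle `a b c`. -/
def sdet (a b c : ℝ × ℝ) : ℝ :=
  (b.1 - a.1) * (c.2 - a.2) - (b.2 - a.2) * (c.1 - a.1)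

/-- Proper crossing of the segments `a b` and `c d`. -/
def PCross (a b c d : ℝ × ℝ) : Prop :=
  sdet a b c * sdet a b d < 0 ∧ sdet c d a * sdet c d b < 0

/-- `p` lies strictly inside the triangle `a b c`. -/
def InTri (a b c p : ℝ × ℝ) : Prop :=
  (0 < sdet a b p ∧ 0 < sdet b c p ∧ 0 < sdet c a p) ∨
  (sdet a b p < 0 ∧ sdet b c p < 0 ∧ sdet c a p < 0)

theorem sdet_rot (a b c : ℝ × ℝ) : sdet b c a = sdet a b c := by
  simp only [sdet]; ring

theorem sdet_swap (a b c : ℝ × ℝ) : sdet b a c = - sdet a b c := by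
  simp only [sdet]; ring

theorem sdet_swap' (a b c : ℝ × ℝ) : sdet a c b = - sdet a b c := by
  simp only [sdet]; ring

theorem InTri.rot {a b c p : ℝ × ℝ} (h : InTri a b c p) : InTri b c a p := by
  simp only [InTri] at *; tauto

theorem InTri.swap {a b c p : ℝ × ℝ} (h : InTri a b c p) : InTri b a c p := by
  simp only [InTri] at *
  rw [sdet_swap a b p, sdet_swap c a p, sdet_swap b c p]
  rcases h with ⟨h1, h2, h3⟩ | ⟨h1, h2, h3⟩
  · right; refine ⟨?_, ?_, ?_⟩ <;> linarith
  · left; refine ⟨?_, ?_, ?_⟩ <;> linarith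

theorem sdet_sum (a b c x : ℝ × ℝ) : sdet a b x + sdet b c x + sdet c a x = sdet a b c := by
  simp only [sdet]; ring

theorem half_identity (x y z a b : ℝ × ℝ) :
    sdet y z a * sdet a b x + sdet z x a * sdet a b y + sdet x y a * sdet a b z = 0 := by
  simp only [sdet]; ring

/-- A line through an interior point does not leave all corners on its positive side. -/
theorem tri_half_pos {x y z a b : ℝ × ℝ} (h : InTri x y z a)
    (hx : 0 < sdet a b x) (hy : 0 < sdet a b y) (hz : 0 < sdet a b z) : False := by
  have := half_identity x y z a b
  rcases h with ⟨h1, h2, h3⟩ | ⟨h1, h2, h3⟩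
  · have := mul_pos h2 hx; have := mul_pos h3 hy; have := mul_pos h1 hz; linarith
  · have := mul_neg_of_neg_of_pos h2 hx; have := mul_neg_of_neg_of_pos h3 hy
    have := mul_neg_of_neg_of_pos h1 hz; linarith

theorem tri_half_neg {x y z a b : ℝ × ℝ} (h : InTri x y z a)
    (hx : sdet a b x < 0) (hy : sdet a b y < 0) (hz : sdet a b z < 0) : False := by
  have := half_identity x y z a b
  rcases h with ⟨h1, h2, h3⟩ | ⟨h1, h2, h3⟩
  · have := mul_neg_of_pos_of_neg h2 hx; have := mul_neg_of_pos_of_neg h3 hy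
    have := mul_neg_of_pos_of_neg h1 hz; linarith
  · have := mul_pos_of_neg_of_neg h2 hx; have := mul_pos_of_neg_of_neg h3 hy
    have := mul_pos_of_neg_of_neg h1 hz; linarith

/-- Orientation of a triangle agrees with that seen from an interior point. -/
theorem InTri.sign {a b c p : ℝ × ℝ} (h : InTri a b c p) :
    (0 < sdet a b p ∧ 0 < sdet a b c) ∨ (sdet a b p < 0 ∧ sdet a b c < 0) := by
  have := sdet_sum a b c p
  rcases h with ⟨h1, h2, h3⟩ | ⟨h1, h2, h3⟩
  · left; constructor <;> linarith
  · right; constructor <;> linarith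

/-- Two triangles on apexes cannot contain the vertices of each other. -/
theorem no_mutual {q a b q' c d : ℝ × ℝ}
    (h1 : InTri q a b q' ∨ q' = q) (h2 : InTri q a b c) (h3 : InTri q a b d)
    (h4 : InTri q' c d a) : False := by
  have s2 := (InTri.rot h2).sign
  have s3 := (InTri.rot h3).sign
  have s1 : (0 < sdet a b q' ∧ 0 < sdet a b q) ∨ (sdet a b q' < 0 ∧ sdet a b q < 0) := by
    rcases h1 with h1 | h1
    · exact (InTri.rot h1).sign
    · subst h1
      rcases s2 with s2 | s2
      · exact Or.inl ⟨s2.2, s2.2⟩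
      · exact Or.inr ⟨s2.2, s2.2⟩
  rcases s2 with s2 | s2 <;> rcases s3 with s3 | s3 <;> rcases s1 with s1 | s1
  all_goals first
    | exact tri_half_pos h4 s1.1 s2.1 s3.1
    | exact tri_half_neg h4 s1.1 s2.1 s3.1
    | (exfalso; linarith [s1.2, s2.2, s3.2])

theorem no_mutual4 {q q' a b : ℝ × ℝ} (h1 : InTri q a b q') (h2 : InTri q' a b q) : False := by
  simp only [InTri] at *
  have e1 : sdet q a q' = - sdet q' a q := by simp only [sdet]; ring
  rcases h1 with h1 | h1 <;> rcases h2 with h2 | h2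
  · linarith [h1.1, h2.1]
  · have := sdet_sum q a b q'
    have := sdet_sum q' a b q
    linarith [sdet_rot q a b, sdet_rot q' a b, h1.2.1, h2.2.1, h1.1, h1.2.2, h2.1, h2.2.2]
  · have := sdet_sum q a b q'
    have := sdet_sum q' a b q
    linarith [sdet_rot q a b, sdet_rot q' a b, h1.2.1, h2.2.1, h1.1, h1.2.2, h2.1, h2.2.2]
  · linarith [h1.1, h2.1]

/-- Some cone spanned by two corners at an interior point `x` contains `y`. -/
theorem cone3 {a b c x y : ℝ × ℝ} (h1 : 0 < sdet a b x) (h2 : 0 < sdet b c x)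
    (h3 : 0 < sdet c a x) (ga : sdet x a y ≠ 0) (gb : sdet x b y ≠ 0) (gc : sdet x c y ≠ 0) :
    (0 < sdet x a y ∧ sdet x b y < 0) ∨ (0 < sdet x b y ∧ sdet x c y < 0) ∨
    (0 < sdet x c y ∧ sdet x a y < 0) := by
  have hin : InTri a b c x := Or.inl ⟨h1, h2, h3⟩
  have ea : sdet x y a = - sdet x a y := sdet_swap' _ _ _
  have eb : sdet x y b = - sdet x b y := sdet_swap' _ _ _
  have ec : sdet x y c = - sdet x c y := sdet_swap' _ _ _
  rcases lt_or_gt_of_ne ga with ha | ha <;> rcases lt_or_gt_of_ne gb with hb | hb <;>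
    rcases lt_or_gt_of_ne gc with hc | hc
  all_goals first
    | tauto
    | exact (tri_half_pos (b := y) hin (by linarith) (by linarith) (by linarith)).elim
    | exact (tri_half_neg (b := y) hin (by linarith) (by linarith) (by linarith)).elim

theorem sep_aux {a b c x y : ℝ × ℝ} (h1 : 0 < sdet a b x) (h2 : 0 < sdet b c x)
    (h3 : 0 < sdet c a x) (ga : 0 < sdet x a y) (gb : sdet x b y < 0)
    (g : sdet a b y ≠ 0) (nc : ¬ PCross x y a b) : InTri a b c y := by
  have ea : sdet x y a = - sdet x a y := sdet_swap' _ _ _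
  have eb : sdet x y b = - sdet x b y := sdet_swap' _ _ _
  have hy : 0 < sdet a b y := by
    by_contra hh
    have hlt : sdet a b y < 0 := lt_of_le_of_ne (not_lt.mp hh) g
    apply nc
    refine ⟨?_, mul_neg_of_pos_of_neg h1 hlt⟩
    rw [ea, eb]; nlinarith
  have habc : 0 < sdet a b c := by have := sdet_sum a b c x; linarith
  have i1 : sdet a b x * sdet b c y = sdet a b y * sdet b c x + (- sdet x b y) * sdet a b c := by
    simp only [sdet]; ring
  have i2 : sdet a b x * sdet c a y = sdet a b y * sdet c a x + (sdet x a y) * sdet a b c := by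
    simp only [sdet]; ring
  left
  refine ⟨hy, ?_, ?_⟩
  · have : 0 < sdet a b x * sdet b c y := by
      rw [i1]; have := mul_pos hy h2; have := mul_pos (neg_pos.mpr gb) habc; linarith
    exact (pos_iff_pos_of_mul_pos this).mp h1
  · have : 0 < sdet a b x * sdet c a y := by
      rw [i2]; have := mul_pos hy h3; have := mul_pos ga habc; linarith
    exact (pos_iff_pos_of_mul_pos this).mp h1

theorem sep_pos {a b c x y : ℝ × ℝ} (h1 : 0 < sdet a b x) (h2 : 0 < sdet b c x)
    (h3 : 0 < sdet c a x) (ga : sdet x a y ≠ 0) (gb : sdet x b y ≠ 0) (gc : sdet x c y ≠ 0)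
    (gab : sdet a b y ≠ 0) (gbc : sdet b c y ≠ 0) (gca : sdet c a y ≠ 0)
    (nab : ¬ PCross x y a b) (nbc : ¬ PCross x y b c) (nca : ¬ PCross x y c a) :
    InTri a b c y := by
  rcases cone3 h1 h2 h3 ga gb gc with h | h | h
  · exact sep_aux h1 h2 h3 h.1 h.2 gab nab
  · exact (sep_aux h2 h3 h1 h.1 h.2 gbc nbc).rot.rot
  · exact (sep_aux h3 h1 h2 h.1 h.2 gca nca).rot

theorem PCross.swap_right {a b c d : ℝ × ℝ} (h : PCross a b c d) : PCross a b d c := by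
  refine ⟨by rw [mul_comm]; exact h.1, ?_⟩
  rw [sdet_swap c d a, sdet_swap c d b, neg_mul_neg]; exact h.2

theorem PCross.symm {a b c d : ℝ × ℝ} (h : PCross a b c d) : PCross c d a b := ⟨h.2, h.1⟩

theorem PCross.swap_left {a b c d : ℝ × ℝ} (h : PCross a b c d) : PCross b a c d :=
  h.symm.swap_right.symm

theorem sdet_swap_ne {a b c : ℝ × ℝ} (h : sdet a b c ≠ 0) : sdet b a c ≠ 0 := by
  rw [sdet_swap]; exact neg_ne_zero.mpr h

/-- Separation by a triangle. -/
theorem sep {a b c x y : ℝ × ℝ} (hin : InTri a b c x)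
    (ga : sdet x a y ≠ 0) (gb : sdet x b y ≠ 0) (gc : sdet x c y ≠ 0)
    (gab : sdet a b y ≠ 0) (gbc : sdet b c y ≠ 0) (gca : sdet c a y ≠ 0)
    (nab : ¬ PCross x y a b) (nbc : ¬ PCross x y b c) (nca : ¬ PCross x y c a) :
    InTri a b c y := by
  rcases hin with ⟨h1, h2, h3⟩ | ⟨h1, h2, h3⟩
  · exact sep_pos h1 h2 h3 ga gb gc gab gbc gca nab nbc nca
  · apply InTri.swap
    refine sep_pos ?_ ?_ ?_ gb ga gc (sdet_swap_ne gab) (sdet_swap_ne gca) (sdet_swap_ne gbc)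
      (fun h => nab h.swap_right) (fun h => nca h.swap_right) (fun h => nbc h.swap_right)
    · rw [sdet_swap]; linarith
    · rw [sdet_swap]; linarith
    · rw [sdet_swap]; linarith

theorem split_pos {a b c x y : ℝ × ℝ} (hx : 0 < sdet a b x ∧ 0 < sdet b c x ∧ 0 < sdet c a x)
    (hy : InTri a b c y)
    (ga : sdet x a y ≠ 0) (gb : sdet x b y ≠ 0) (gc : sdet x c y ≠ 0) :
    InTri a b x y ∨ InTri b c x y ∨ InTri c a x y := by
  obtain ⟨h1, h2, h3⟩ := hx
  have hy' : 0 < sdet a b y ∧ 0 < sdet b c y ∧ 0 < sdet c a y := by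
    rcases hy with h | h
    · exact h
    · have := sdet_sum a b c x
      have := sdet_sum a b c y
      linarith [h.1, h.2.1, h.2.2]
  have ea := sdet_swap x a y
  have eb := sdet_swap x b y
  have ec := sdet_swap x c y
  rcases cone3 h1 h2 h3 ga gb gc with h | h | h
  · left; left; exact ⟨hy'.1, by linarith [h.2], h.1⟩
  · right; left; left; exact ⟨hy'.2.1, by linarith [h.2], h.1⟩
  · right; right; left; exact ⟨hy'.2.2, by linarith [h.2], h.1⟩

/-- An interior point splits a triangle into three. -/
theorem tri_split {a b c x y : ℝ × ℝ} (hx : InTri a b c x) (hy : InTri a b c y)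
    (ga : sdet x a y ≠ 0) (gb : sdet x b y ≠ 0) (gc : sdet x c y ≠ 0) :
    InTri a b x y ∨ InTri b c x y ∨ InTri c a x y := by
  rcases hx with hx | hx
  · exact split_pos hx hy ga gb gc
  · have := split_pos (a := b) (b := a) (c := c) (x := x) (y := y)
      ⟨by rw [sdet_swap]; linarith [hx.1], by rw [sdet_swap]; linarith [hx.2.2],
        by rw [sdet_swap]; linarith [hx.2.1]⟩ hy.swap gb ga gc
    rcases this with h | h | h
    · exact Or.inl h.swap
    · exact Or.inr (Or.inr h.swap)
    · exact Or.inr (Or.inl h.swap)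

/-- If `x` is inside `a b c` then `c` is not inside `a b x`. -/
theorem tri_excl {a b c x : ℝ × ℝ} (hx : InTri a b c x) (hc : InTri a b x c) : False :=
  no_mutual4 hx.rot.rot hc.rot.rot

/-- Two points on the same side of a segment. -/
theorem same_side {a b p p' : ℝ × ℝ} (hs : 0 < sdet a b p * sdet a b p')
    (g1 : sdet a p p' ≠ 0) (g2 : sdet b p p' ≠ 0)
    (n1 : ¬ PCross p a p' b) (n2 : ¬ PCross p b p' a) :
    InTri a b p p' ∨ InTri a b p' p := by
  have key := sdet_sum a b p p'
  simp only [InTri, PCross] at *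
  have e1 : sdet p a p' = - sdet a p p' := sdet_swap _ _ _
  have e2 : sdet p' a p = sdet a p p' := by simp only [sdet]; ring
  have e3 : sdet p b p' = - sdet b p p' := sdet_swap _ _ _
  have e4 : sdet p' b p = sdet b p p' := by simp only [sdet]; ring
  have e5 : sdet b p' p = - sdet b p p' := sdet_swap' _ _ _
  have e6 : sdet p a b = sdet a b p := by simp only [sdet]; ring
  have e7 : sdet p b a = - sdet a b p := by simp only [sdet]; ring
  have e8 : sdet p' a b = sdet a b p' := by simp only [sdet]; ring
  have e9 : sdet p' b a = - sdet a b p' := by simp only [sdet]; ring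
  simp only [e1, e2, e3, e4, e5, e6, e7, e8, e9] at n1 n2 key ⊢
  clear e1 e2 e3 e4 e5 e6 e7 e8 e9
  generalize sdet a b p = A at *
  generalize sdet a b p' = B at *
  generalize sdet a p p' = C at *
  generalize sdet b p p' = E at *
  have hAB : (0 < A ∧ 0 < B) ∨ (A < 0 ∧ B < 0) := mul_pos_iff.mp hs
  simp only [mul_neg_iff] at n1 n2
  rcases hAB with ⟨hA, hB⟩ | ⟨hA, hB⟩ <;> rcases lt_or_gt_of_ne g1 with hC | hC <;>
    rcases lt_or_gt_of_ne g2 with hE | hE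
  all_goals first
    | (left; left; refine ⟨?_, ?_, ?_⟩ <;> linarith)
    | (left; right; refine ⟨?_, ?_, ?_⟩ <;> linarith)
    | (right; left; refine ⟨?_, ?_, ?_⟩ <;> linarith)
    | (right; right; refine ⟨?_, ?_, ?_⟩ <;> linarith)
    | (exfalso; apply n1; constructor <;> first
        | (left; constructor <;> linarith) | (right; constructor <;> linarith))
    | (exfalso; apply n2; constructor <;> first
        | (left; constructor <;> linarith) | (right; constructor <;> linarith))

/-- A plane straight-line `K₄` has a vertex inside the triangle of the others. -/
theorem k4_inside {q a b r : ℝ × ℝ} (g1 : sdet q a r ≠ 0) (g2 : sdet a b r ≠ 0)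
    (g3 : sdet b q r ≠ 0) (g4 : sdet q a b ≠ 0) (n1 : ¬ PCross r q a b) (n2 : ¬ PCross r a b q)
    (n3 : ¬ PCross r b q a) :
    InTri q a b r ∨ InTri a b r q ∨ InTri b q r a ∨ InTri q a r b := by
  by_cases h : 0 < sdet a b q * sdet a b r
  · have := same_side (a := a) (b := b) (p := q) (p' := r) h
      (by rw [sdet_swap]; exact neg_ne_zero.mpr g1) g3
      (fun h => n3 h.symm) (fun h => n2 h.symm.swap_right)
    rcases this with h | h
    · exact Or.inl h.rot.rot
    · exact Or.inr (Or.inl h)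
  · have ha : sdet a b q ≠ 0 := by rw [sdet_rot]; exact g4
    have hlt : sdet a b q * sdet a b r < 0 :=
      lt_of_le_of_ne (not_lt.mp h) (mul_ne_zero ha g2)
    have hx : 0 ≤ sdet r q a * sdet r q b := by
      by_contra hh
      exact n1 ⟨not_le.mp hh, by rw [mul_comm] at hlt; rw [mul_comm]; nlinarith [hlt]⟩
    have e1 : sdet r q a = sdet q a r := by simp only [sdet]; ring
    have e2 : sdet r q b = - sdet b q r := by simp only [sdet]; ring
    have e3 : sdet q r a = - sdet q a r := by simp only [sdet]; ring
    have e4 : sdet r b a = - sdet a b r := by simp only [sdet]; ring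
    have e5 : sdet b q a = sdet a b q := by simp only [sdet]; ring
    have e6 : sdet a r b = - sdet a b r := by simp only [sdet]; ring
    have e7 : sdet r q b = - sdet b q r := by simp only [sdet]; ring
    have e8 : sdet q a b = sdet a b q := by simp only [sdet]; ring
    have key := sdet_sum q a b r
    rw [e1, e2] at hx
    simp only [InTri]
    simp only [e3, e4, e5, e6, e7, e8]
    rw [e8] at key
    clear e1 e2 e3 e4 e5 e6 e7 e8
    clear n1 n2 n3 g4 h
    generalize sdet a b q = A at *
    generalize sdet a b r = B at *
    generalize sdet q a r = C at *
    generalize sdet b q r = E at *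
    rcases lt_or_gt_of_ne g1 with hC | hC <;> rcases lt_or_gt_of_ne g3 with hE | hE <;>
      rcases lt_or_gt_of_ne ha with hA | hA <;> rcases lt_or_gt_of_ne g2 with hB | hB
    all_goals first
      | (exfalso; linarith)
      | (exfalso; nlinarith)
      | (right; right; left; left; refine ⟨?_, ?_, ?_⟩ <;> linarith)
      | (right; right; left; right; refine ⟨?_, ?_, ?_⟩ <;> linarith)
      | (right; right; right; left; refine ⟨?_, ?_, ?_⟩ <;> linarith)
      | (right; right; right; right; refine ⟨?_, ?_, ?_⟩ <;> linarith)

/-- The opposite-edges contradiction for a quadrilateral, positively oriented. -/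
theorem quad_pos {p1 p2 p3 p4 q q' : ℝ × ℝ}
    (h3 : InTri q p1 p2 p3) (h4 : InTri q p1 p2 p4)
    (h1 : InTri q' p3 p4 p1) (h2 : InTri q' p3 p4 p2)
    (n : ¬ PCross p2 p3 p4 p1) (hp : 0 < sdet p1 p2 q) : False := by
  have hs := sdet_rot q p1 p2
  have k3 : 0 < sdet q p1 p3 ∧ 0 < sdet p1 p2 p3 ∧ 0 < sdet p2 q p3 := by
    rcases h3 with h | h
    · exact h
    · have := sdet_sum q p1 p2 p3; linarith [h.1, h.2.1, h.2.2]
  have k4 : 0 < sdet q p1 p4 ∧ 0 < sdet p1 p2 p4 ∧ 0 < sdet p2 q p4 := by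
    rcases h4 with h | h
    · exact h
    · have := sdet_sum q p1 p2 p4; linarith [h.1, h.2.1, h.2.2]
  have hs' := sdet_rot q' p3 p4
  have s1 := sdet_sum q' p3 p4 p1
  have s2 := sdet_sum q' p3 p4 p2
  rcases h1 with h1 | h1 <;> rcases h2 with h2 | h2
  · -- both directions converge
    have c1 : sdet p1 p2 q * ((p4.1 - p1.1) * (p3.2 - p2.2) - (p4.2 - p1.2) * (p3.1 - p2.1))
        = sdet q p1 p4 * sdet p1 p2 p3 + sdet p2 q p3 * sdet p1 p2 p4 
          + sdet p1 p2 p3 * sdet p1 p2 p4 := by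
      simp only [sdet]; ring
    have c2 : sdet p3 p4 q' * ((p2.1 - p3.1) * (p1.2 - p4.2) - (p2.2 - p3.2) * (p1.1 - p4.1))
        = sdet q' p3 p2 * sdet p3 p4 p1 + sdet p4 q' p1 * sdet p3 p4 p2 
          + sdet p3 p4 p1 * sdet p3 p4 p2 := by
      simp only [sdet]; ring
    have d1 : 0 < sdet p1 p2 q * ((p4.1 - p1.1) * (p3.2 - p2.2) - (p4.2 - p1.2) * (p3.1 - p2.1)) := by
      rw [c1]
      have := mul_pos k4.1 k3.2.1; have := mul_pos k3.2.2 k4.2.1; have := mul_pos k3.2.1 k4.2.1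
      linarith
    have d2 : 0 < sdet p3 p4 q' * ((p2.1 - p3.1) * (p1.2 - p4.2) - (p2.2 - p3.2) * (p1.1 - p4.1)) := by
      rw [c2]
      have := mul_pos h2.1 h1.2.1; have := mul_pos h1.2.2 h2.2.1; have := mul_pos h1.2.1 h2.2.1
      linarith
    have hq' : 0 < sdet p3 p4 q' := by linarith [h1.1, h1.2.1, h1.2.2]
    have f1 := (pos_iff_pos_of_mul_pos d1).mp hp
    have f2 := (pos_iff_pos_of_mul_pos d2).mp hq'
    linarith
  · linarith [h1.1, h1.2.1, h1.2.2, h2.1, h2.2.1, h2.2.2]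
  · linarith [h1.1, h1.2.1, h1.2.2, h2.1, h2.2.1, h2.2.2]
  · apply n
    have e1 : sdet p2 p3 p4 = sdet p3 p4 p2 := by simp only [sdet]; ring
    have e2 : sdet p2 p3 p1 = sdet p1 p2 p3 := by simp only [sdet]; ring
    have e3 : sdet p4 p1 p2 = sdet p1 p2 p4 := by simp only [sdet]; ring
    have e4 : sdet p4 p1 p3 = sdet p3 p4 p1 := by simp only [sdet]; ring
    constructor
    · rw [e1, e2]; exact mul_neg_of_neg_of_pos h2.2.1 k3.2.1
    · rw [e3, e4]; exact mul_neg_of_pos_of_neg k4.2.1 h1.2.1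

theorem quad_contra {p1 p2 p3 p4 q q' : ℝ × ℝ}
    (h3 : InTri q p1 p2 p3) (h4 : InTri q p1 p2 p4)
    (h1 : InTri q' p3 p4 p1) (h2 : InTri q' p3 p4 p2)
    (n : ¬ PCross p2 p3 p4 p1) : False := by
  rcases h3.rot.sign with hp | hp
  · exact quad_pos h3 h4 h1 h2 n hp.2
  · -- reverse the roles: p2 p1 p4 p3
    refine quad_pos (p1 := p2) (p2 := p1) (p3 := p4) (p4 := p3) (q := q) (q' := q')
      h4.swap.rot ?_ ?_ ?_ ?_ (by rw [sdet_swap]; linarith [hp.2])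
    · exact h3.swap.rot
    · exact h2.swap.rot
    · exact h1.swap.rot
    · exact fun h => n h.symm.swap_right.swap_left

/-- If all triangles `q aᵢ aᵢ₊₁` are positive, `p` sees the cycle in the same sense, then `p`
is inside one of the triangles. -/
theorem wheel_pos {q q' a1 a2 a3 a4 : ℝ × ℝ}
    (h1 : 0 < sdet q a1 a2) (h2 : 0 < sdet q a2 a3) (h3 : 0 < sdet q a3 a4) (h4 : 0 < sdet q a4 a1)
    (k1 : 0 < sdet q' a1 a2) (k2 : 0 < sdet q' a2 a3) (k3 : 0 < sdet q' a3 a4)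
    (k4 : 0 < sdet q' a4 a1)
    (g1 : sdet q a1 q' ≠ 0) (g2 : sdet q a2 q' ≠ 0) (g3 : sdet q a3 q' ≠ 0) (g4 : sdet q a4 q' ≠ 0) :
    InTri q a1 a2 q' ∨ InTri q a2 a3 q' ∨ InTri q a3 a4 q' ∨ InTri q a4 a1 q' := by
  have mk : ∀ x y : ℝ × ℝ, 0 < sdet q' x y → 0 < sdet q x q' → sdet q y q' < 0 →
      InTri q x y q' := by
    intro x y hk hx hy
    left
    refine ⟨hx, by rw [sdet_rot]; exact hk, by rw [sdet_swap]; linarith⟩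
  have tr : ∀ x y z : ℝ × ℝ, 0 < sdet q x q' * sdet q y q' → 0 < sdet q y q' * sdet q z q' →
      0 < sdet q x y → 0 < sdet q y z → 0 < sdet q x z := by
    intro x y z hxy hyz h h'
    have id : sdet q y q' * sdet q x z = sdet q x q' * sdet q y z + sdet q z q' * sdet q x y := by
      simp only [sdet]; ring
    have : 0 < sdet q y q' ^ 2 * sdet q x z := by
      have e : sdet q y q' ^ 2 * sdet q x z = (sdet q x q' * sdet q y q') * sdet q y z
         + (sdet q y q' * sdet q z q') * sdet q x y := by
        rw [pow_two, mul_assoc, id]; ring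
      rw [e]
      have := mul_pos hxy h'; have := mul_pos hyz h; linarith
    exact pos_of_mul_pos_right this (sq_nonneg _)
  have bad : ∀ (_ : 0 < sdet q a1 q' * sdet q a2 q') (_ : 0 < sdet q a2 q' * sdet q a3 q')
      (_ : 0 < sdet q a1 q' * sdet q a3 q') (_ : 0 < sdet q a3 q' * sdet q a4 q'), False := by
    intro u1 u2 u3 u4
    have v1 := tr _ _ _ u1 u2 h1 h2
    have v2 := tr _ _ _ u3 u4 v1 h3
    have := sdet_swap' q a1 a4
    linarith
  rcases lt_or_gt_of_ne g1 with f1 | f1 <;> rcases lt_or_gt_of_ne g2 with f2 | f2 <;>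
    rcases lt_or_gt_of_ne g3 with f3 | f3 <;> rcases lt_or_gt_of_ne g4 with f4 | f4
  all_goals first
    | exact Or.inl (mk _ _ k1 f1 f2)
    | exact Or.inr (Or.inl (mk _ _ k2 f2 f3))
    | exact Or.inr (Or.inr (Or.inl (mk _ _ k3 f3 f4)))
    | exact Or.inr (Or.inr (Or.inr (mk _ _ k4 f4 f1)))
    | exact (bad (mul_pos f1 f2) (mul_pos f2 f3) (mul_pos f1 f3) (mul_pos f3 f4)).elim
    | exact (bad (mul_pos_of_neg_of_neg f1 f2) (mul_pos_of_neg_of_neg f2 f3)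
        (mul_pos_of_neg_of_neg f1 f3) (mul_pos_of_neg_of_neg f3 f4)).elim

/-! Perturbation to general position -/

theorem not_cross_of_sep {a b c d : ℝ × ℝ} (α β γ : ℝ)
    (ha : α * a.1 + β * a.2 < γ) (hb : α * b.1 + β * b.2 < γ)
    (hc : γ < α * c.1 + β * c.2) (hd : γ < α * d.1 + β * d.2) : ¬ PCross a b c d := by
  rintro ⟨h1, h2⟩
  have e1 : sdet c d b - sdet c d a = - (sdet a b d - sdet a b c) := by
    simp only [sdet]; ring
  have e2 : (α * a.1 + β * a.2) * sdet c d b - (α * b.1 + β * b.2) * sdet c d a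
      + (α * c.1 + β * c.2) * sdet a b d - (α * d.1 + β * d.2) * sdet a b c = 0 := by
    simp only [sdet]; ring
  generalize sdet c d b = S at *
  generalize sdet c d a = S' at *
  generalize sdet a b d = T at *
  generalize sdet a b c = T' at *
  generalize α * a.1 + β * a.2 = A at *
  generalize α * b.1 + β * b.2 = B at *
  generalize α * c.1 + β * c.2 = C at *
  generalize α * d.1 + β * d.2 = E at *
  rcases mul_neg_iff.mp h1 with ⟨p1, p2⟩ | ⟨p1, p2⟩ <;>
    rcases mul_neg_iff.mp h2 with ⟨p3, p4⟩ | ⟨p3, p4⟩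
  · linarith
  · have t1 := mul_pos (sub_pos.mpr ha) p4
    have t2 := mul_pos (sub_pos.mpr hb) (neg_pos.mpr p3)
    have t3 := mul_pos (sub_pos.mpr hc) (neg_pos.mpr p2)
    have t4 := mul_pos (sub_pos.mpr hd) p1
    have : γ * (S - S') = γ * (-(T - T')) := by rw [e1]
    nlinarith
  · have t1 := mul_pos (sub_pos.mpr ha) (neg_pos.mpr p4)
    have t2 := mul_pos (sub_pos.mpr hb) p3
    have t3 := mul_pos (sub_pos.mpr hc) p2
    have t4 := mul_pos (sub_pos.mpr hd) (neg_pos.mpr p1)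
    have : γ * (S - S') = γ * (-(T - T')) := by rw [e1]
    nlinarith
  · linarith

theorem segment_sep {a b c d : ℝ × ℝ} (h : Disjoint (segment ℝ a b) (segment ℝ c d)) :
    ∃ α β γ : ℝ, α * a.1 + β * a.2 < γ ∧ α * b.1 + β * b.2 < γ ∧
      γ < α * c.1 + β * c.2 ∧ γ < α * d.1 + β * d.2 := by
  have comp : ∀ x y : ℝ × ℝ, IsCompact (segment ℝ x y) := by
    intro x y
    rw [segment_eq_image_lineMap]
    exact isCompact_Icc.image (by fun_prop)
  obtain ⟨f, u, v, h1, h2, h3⟩ := geometric_hahn_banach_compact_closed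
    (convex_segment a b) (comp a b) (convex_segment c d) (comp c d).isClosed h
  have hf : ∀ p : ℝ × ℝ, f p = f (1, 0) * p.1 + f (0, 1) * p.2 := by
    intro p
    have : p = p.1 • ((1 : ℝ), (0 : ℝ)) + p.2 • ((0 : ℝ), (1 : ℝ)) := by
      ext <;> simp
    conv_lhs => rw [this]
    rw [map_add, map_smul, map_smul]
    simp only [smul_eq_mul]; ring
  refine ⟨f (1, 0), f (0, 1), u, ?_, ?_, ?_, ?_⟩
  · rw [← hf]; exact h1 _ (left_mem_segment ℝ a b)
  · rw [← hf]; exact h1 _ (right_mem_segment ℝ a b)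
  · rw [← hf]; exact h2.trans (h3 _ (left_mem_segment ℝ c d))
  · rw [← hf]; exact h2.trans (h3 _ (right_mem_segment ℝ c d))

theorem quad_finite (c0 c1 c2 : ℝ) (h : c2 ≠ 0) :
    ∀ᶠ ε in nhdsWithin (0 : ℝ) {0}ᶜ, c0 + c1 * ε + c2 * ε ^ 2 ≠ 0 := by
  have hfin : {ε : ℝ | c0 + c1 * ε + c2 * ε ^ 2 = 0}.Finite := by
    have hp : (Polynomial.C c0 + Polynomial.C c1 * Polynomial.X
        + Polynomial.C c2 * Polynomial.X ^ 2 : Polynomial ℝ) ≠ 0 := by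
      intro h0
      have := congrArg (fun p => Polynomial.coeff p 2) h0
      simp [Polynomial.coeff_X, Polynomial.coeff_C] at this
      exact h this
    refine (Polynomial.finite_setOfPred_isRoot hp).subset ?_
    intro ε hε
    simpa [Polynomial.IsRoot] using hε
  have h2 : ({ε : ℝ | c0 + c1 * ε + c2 * ε ^ 2 = 0} \ {0}).Finite := hfin.subset Set.sdiff_subset
  have h3 := h2.isClosed.isOpen_compl
  have h4 : ({ε : ℝ | c0 + c1 * ε + c2 * ε ^ 2 = 0} \ {0})ᶜ ∈ nhds (0 : ℝ) :=
    h3.mem_nhds (by simp)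
  filter_upwards [mem_nhdsWithin_of_mem_nhds h4, self_mem_nhdsWithin] with ε h5 h6 h7
  exact h5 ⟨h7, h6⟩

theorem perturb {V : Type*} [Finite V] (D : V → ℝ × ℝ) (P : V → V → V → V → Prop)
    (hP : ∀ u v x y, P u v x y → Disjoint (segment ℝ (D u) (D v)) (segment ℝ (D x) (D y))) :
    ∃ D' : V → ℝ × ℝ, (∀ u v w, u ≠ v → v ≠ w → u ≠ w → sdet (D' u) (D' v) (D' w) ≠ 0) ∧
      ∀ u v x y, P u v x y → ¬ PCross (D' u) (D' v) (D' x) (D' y) := by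
  obtain ⟨n, ⟨eq⟩⟩ := Finite.exists_equiv_fin V
  let k : V → ℝ := fun v => ((eq v : ℕ) : ℝ)
  have hk : ∀ u v, u ≠ v → k u ≠ k v := by
    intro u v huv h
    apply huv
    apply eq.injective
    apply Fin.ext
    have h' : ((eq u : ℕ) : ℝ) = ((eq v : ℕ) : ℝ) := h
    exact_mod_cast h'
  let F : ℝ → V → ℝ × ℝ := fun ε v => ((D v).1 + ε * k v, (D v).2 + ε * (k v) ^ 2)
  have E1 : ∀ᶠ ε in nhdsWithin (0 : ℝ) {0}ᶜ, ∀ u v w, u ≠ v → v ≠ w → u ≠ w →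
      sdet (F ε u) (F ε v) (F ε w) ≠ 0 := by
    rw [Filter.eventually_all]; intro u
    rw [Filter.eventually_all]; intro v
    rw [Filter.eventually_all]; intro w
    rw [Filter.eventually_imp_distrib_left]; intro h1
    rw [Filter.eventually_imp_distrib_left]; intro h2
    rw [Filter.eventually_imp_distrib_left]; intro h3
    have hne : (k v - k u) * (k w - k u) * (k w - k v) ≠ 0 :=
      mul_ne_zero (mul_ne_zero (sub_ne_zero.mpr (hk _ _ h1.symm)) (sub_ne_zero.mpr (hk _ _ h3.symm)))
        (sub_ne_zero.mpr (hk _ _ h2.symm))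
    filter_upwards [quad_finite (sdet (D u) (D v) (D w))
      (((D v).1 - (D u).1) * (k w ^ 2 - k u ^ 2) + (k v - k u) * ((D w).2 - (D u).2)
        - ((D v).2 - (D u).2) * (k w - k u) - (k v ^ 2 - k u ^ 2) * ((D w).1 - (D u).1)) _ hne]
      with ε hε h0
    apply hε
    rw [← h0]
    simp only [F, sdet]
    ring
  have E2 : ∀ᶠ ε in nhdsWithin (0 : ℝ) {0}ᶜ, ∀ u v x y, P u v x y →
      ¬ PCross (F ε u) (F ε v) (F ε x) (F ε y) := by
    rw [Filter.eventually_all]; intro u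
    rw [Filter.eventually_all]; intro v
    rw [Filter.eventually_all]; intro x
    rw [Filter.eventually_all]; intro y
    rw [Filter.eventually_imp_distrib_left]; intro hp
    obtain ⟨α, β, γ, hu, hv, hx, hy⟩ := segment_sep (hP u v x y hp)
    apply Filter.Eventually.filter_mono nhdsWithin_le_nhds
    have cont : ∀ w, Filter.Tendsto (fun ε => α * (F ε w).1 + β * (F ε w).2) (nhds 0)
        (nhds (α * (D w).1 + β * (D w).2)) := by
      intro w
      have hc : Continuous (fun ε => α * (F ε w).1 + β * (F ε w).2) := by
        simp only [F]; fun_prop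
      have := hc.tendsto 0
      simpa [F] using this
    filter_upwards [(cont u).eventually_lt_const hu, (cont v).eventually_lt_const hv,
      (cont x).eventually_const_lt hx, (cont y).eventually_const_lt hy] with ε h1 h2 h3 h4
    exact not_cross_of_sep α β γ h1 h2 h3 h4
  obtain ⟨ε, h1, h2⟩ := (E1.and E2).exists
  exact ⟨F ε, h1, h2⟩

/-! Frames in general position -/

/-- No three vertices are placed on a common line. -/
def GenPos {V : Type*} (D : V → ℝ × ℝ) : Prop :=
  ∀ u v w, u ≠ v → v ≠ w → u ≠ w → sdet (D u) (D v) (D w) ≠ 0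

/-- Independent visible edges do not cross. -/
def NoCross {V : Type*} (G : SimpleGraph V) (S : Set V) (D : V → ℝ × ℝ) : Prop :=
  ∀ u v x y, G.Adj u v → G.Adj x y → u ∈ S → v ∈ S → x ∈ S → y ∈ S →
    u ≠ x → u ≠ y → v ≠ x → v ≠ y → ¬ PCross (D u) (D v) (D x) (D y)

section frames

variable {V : Type*} {G : SimpleGraph V} {S : Set V} {D : V → ℝ × ℝ}

theorem sepV (gp : GenPos D) (nc : NoCross G S D) {a b c x y : V}
    (hab : G.Adj a b) (hbc : G.Adj b c) (hca : G.Adj c a) (hxy : G.Adj x y)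
    (hS : a ∈ S ∧ b ∈ S ∧ c ∈ S ∧ x ∈ S ∧ y ∈ S)
    (hx : x ≠ a ∧ x ≠ b ∧ x ≠ c) (hy : y ≠ a ∧ y ≠ b ∧ y ≠ c)
    (h : InTri (D a) (D b) (D c) (D x)) : InTri (D a) (D b) (D c) (D y) := by
  obtain ⟨sa, sb, sc, sx, sy⟩ := hS
  obtain ⟨xa, xb, xc⟩ := hx
  obtain ⟨ya, yb, yc⟩ := hy
  exact sep h (gp _ _ _ xa ya.symm hxy.ne) (gp _ _ _ xb yb.symm hxy.ne)
    (gp _ _ _ xc yc.symm hxy.ne) (gp _ _ _ hab.ne yb.symm ya.symm)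
    (gp _ _ _ hbc.ne yc.symm yb.symm) (gp _ _ _ hca.ne ya.symm yc.symm)
    (nc _ _ _ _ hxy hab sx sy sa sb xa xb ya yb) (nc _ _ _ _ hxy hbc sx sy sb sc xb xc yb yc)
    (nc _ _ _ _ hxy hca sx sy sc sa xc xa yc ya)

/-- Four apexes over three vertices, two of them adjacent. -/
theorem no_k34 (gp : GenPos D) (nc : NoCross G S D) {a1 a2 a3 : V} {q : Fin 4 → V}
    (hq : Function.Injective q) (h12 : G.Adj a1 a2)
    (h31 : a3 ≠ a1) (h32 : a3 ≠ a2)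
    (e1 : ∀ i, G.Adj (q i) a1) (e2 : ∀ i, G.Adj (q i) a2) (e3 : ∀ i, G.Adj (q i) a3)
    (s1 : a1 ∈ S) (s2 : a2 ∈ S) (s3 : a3 ∈ S) (sq : ∀ i, q i ∈ S) : False := by
  have toall : ∀ i j k, j ≠ i → k ≠ i → InTri (D a1) (D a2) (D (q i)) (D (q j)) →
      InTri (D a1) (D a2) (D (q i)) (D (q k)) := by
    intro i j k hj hk h
    have h3 : InTri (D a1) (D a2) (D (q i)) (D a3) :=
      sepV gp nc h12 (e2 i).symm (e1 i) (e3 j) ⟨s1, s2, sq i, sq j, s3⟩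
        ⟨(e1 j).ne, (e2 j).ne, fun h => hj (hq h)⟩ ⟨h31, h32, (e3 i).ne'⟩ h
    exact sepV gp nc h12 (e2 i).symm (e1 i) (e3 k).symm ⟨s1, s2, sq i, s3, sq k⟩
      ⟨h31, h32, (e3 i).ne'⟩ ⟨(e1 k).ne, (e2 k).ne, fun h => hk (hq h)⟩ h3
  have h0 : ∃ i0, ∀ i, i ≠ i0 → ∀ j, j ≠ i → ¬ InTri (D a1) (D a2) (D (q i)) (D (q j)) := by
    by_cases hex : ∃ i j, j ≠ i ∧ InTri (D a1) (D a2) (D (q i)) (D (q j))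
    · obtain ⟨i, j, hj, hin⟩ := hex
      refine ⟨i, fun k hk l hl hkl => ?_⟩
      have u1 := toall i j k hj hk hin
      have u2 := toall k l i hl hk.symm hkl
      exact no_mutual4 u1.rot.rot u2.rot.rot
    · refine ⟨0, fun i _ j hj h => hex ⟨i, j, hj, h⟩⟩
  obtain ⟨i0, h0⟩ := h0
  have opp : ∀ i j, i ≠ i0 → j ≠ i0 → i ≠ j →
      ¬ 0 < sdet (D a1) (D a2) (D (q i)) * sdet (D a1) (D a2) (D (q j)) := by
    intro i j hi hj hij hpos
    have qij : q i ≠ q j := fun h => hij (hq h)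
    rcases same_side hpos (gp _ _ _ (e1 i).ne' qij (e1 j).ne') (gp _ _ _ (e2 i).ne' qij (e2 j).ne')
      (nc _ _ _ _ (e1 i) (e2 j) (sq i) s1 (sq j) s2 qij (e2 i).ne (e1 j).ne' h12.ne)
      (nc _ _ _ _ (e2 i) (e1 j) (sq i) s2 (sq j) s1 qij (e1 i).ne (e2 j).ne' h12.ne') with h | h
    · exact h0 i hi j hij.symm h
    · exact h0 j hj i hij h
  have nz : ∀ i, sdet (D a1) (D a2) (D (q i)) ≠ 0 := fun i =>
    gp _ _ _ h12.ne (e2 i).ne' (e1 i).ne'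
  have d : ∀ i : Fin 4, i + 1 ≠ i ∧ i + 2 ≠ i ∧ i + 3 ≠ i ∧ i + 1 ≠ i + 2 ∧ i + 2 ≠ i + 3 ∧
    i + 1 ≠ i + 3 := by decide
  obtain ⟨d1, d2, d3, d4, d5, d6⟩ := d i0
  have p1 := opp _ _ d1 d2 d4
  have p2 := opp _ _ d2 d3 d5
  have p3 := opp _ _ d1 d3 d6
  rcases lt_or_gt_of_ne (nz (i0 + 1)) with f1 | f1 <;>
    rcases lt_or_gt_of_ne (nz (i0 + 2)) with f2 | f2 <;>
    rcases lt_or_gt_of_ne (nz (i0 + 3)) with f3 | f3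
  all_goals first
    | exact p1 (mul_pos f1 f2)
    | exact p2 (mul_pos f2 f3)
    | exact p3 (mul_pos f1 f3)
    | exact p1 (mul_pos_of_neg_of_neg f1 f2)
    | exact p2 (mul_pos_of_neg_of_neg f2 f3)
    | exact p3 (mul_pos_of_neg_of_neg f1 f3)

theorem wheel_sign (gp : GenPos D) (nc : NoCross G S D) {z : V} {c : Fin 4 → V}
    (hc : Function.Injective c) (ec : ∀ i, G.Adj (c i) (c (i + 1))) (ez : ∀ i, G.Adj z (c i))
    (sz : z ∈ S) (sc : ∀ i, c i ∈ S)
    (no1 : ∀ i, ¬ InTri (D z) (D (c i)) (D (c (i + 1))) (D (c (i + 2))))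
    (no2 : ∀ i, ¬ InTri (D z) (D (c i)) (D (c (i + 1))) (D (c (i + 3)))) (i : Fin 4) :
    0 < sdet (D z) (D (c i)) (D (c (i + 1))) * sdet (D z) (D (c (i + 1))) (D (c (i + 2))) := by
  have d : ∀ i : Fin 4, i + 2 ≠ i ∧ i + 1 + 1 = i + 2 ∧ i + 1 + 3 = i := by decide
  obtain ⟨d1, d2, d3⟩ := d i
  have n02 : c i ≠ c (i + 2) := fun h => d1 (hc h).symm
  have n01 := (ec i).ne
  have e12 : G.Adj (c (i + 1)) (c (i + 2)) := by have := ec (i + 1); rwa [d2] at this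
  by_contra hneg
  have g1 := gp _ _ _ (ez i).ne n01 (ez (i + 1)).ne
  have g2 := gp _ _ _ (ez (i + 1)).ne e12.ne (ez (i + 2)).ne
  have hlt := lt_of_le_of_ne (not_lt.mp hneg) (mul_ne_zero g1 g2)
  have hpos : 0 < sdet (D z) (D (c (i + 1))) (D (c i)) * sdet (D z) (D (c (i + 1))) (D (c (i + 2))) := by
    rw [sdet_swap' (D z) (D (c i)) (D (c (i + 1)))]; linarith
  rcases same_side hpos (gp _ _ _ (ez i).ne n02 (ez (i + 2)).ne)
    (gp _ _ _ n01.symm n02 e12.ne)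
    (nc _ _ _ _ (ez i).symm e12.symm (sc _) sz (sc _) (sc _) n02 n01 (ez _).ne (ez _).ne)
    (nc _ _ _ _ (ec i) (ez (i + 2)).symm (sc _) (sc _) (sc _) sz n02 (ez _).ne' e12.ne (ez _).ne')
    with h | h
  · exact no1 i h.swap.rot.swap.rot.swap.rot
  · have := no2 (i + 1)
    rw [d2, d3] at this
    exact this h

theorem no_wheel2 (gp : GenPos D) (nc : NoCross G S D) {q q' : V} {c : Fin 4 → V}
    (hqq : q ≠ q')
    (hc : Function.Injective c) (ec : ∀ i, G.Adj (c i) (c (i + 1)))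
    (eq : ∀ i, G.Adj q (c i)) (eq' : ∀ i, G.Adj q' (c i))
    (sq : q ∈ S) (sq' : q' ∈ S) (sc : ∀ i, c i ∈ S)
    (no1 : ∀ i, ¬ InTri (D q) (D (c i)) (D (c (i + 1))) (D (c (i + 2))))
    (no2 : ∀ i, ¬ InTri (D q) (D (c i)) (D (c (i + 1))) (D (c (i + 3))))
    (no1' : ∀ i, ¬ InTri (D q') (D (c i)) (D (c (i + 1))) (D (c (i + 2))))
    (no2' : ∀ i, ¬ InTri (D q') (D (c i)) (D (c (i + 1))) (D (c (i + 3))))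
    (no3 : ∀ i, ¬ InTri (D q) (D (c i)) (D (c (i + 1))) (D q')) : False := by
  have s := wheel_sign gp nc hc ec eq sq sc no1 no2
  have s' := wheel_sign gp nc hc ec eq' sq' sc no1' no2'
  have r : (0 : Fin 4) + 1 = 1 ∧ (0 : Fin 4) + 2 = 2 ∧ (1 : Fin 4) + 1 = 2 ∧ (1 : Fin 4) + 2 = 3 ∧
    (2 : Fin 4) + 1 = 3 ∧ (2 : Fin 4) + 2 = 0 ∧ (3 : Fin 4) + 1 = 0 := by decide
  obtain ⟨r1, r2, r3, r4, r5, r6, r7⟩ := r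
  have s0 := s 0
  have s1 := s 1
  have s2 := s 2
  have s0' := s' 0
  have s1' := s' 1
  have s2' := s' 2
  have m0 := no3 0
  have m1 := no3 1
  have m2 := no3 2
  have m3 := no3 3
  rw [r1] at m0
  rw [r3] at m1
  rw [r5] at m2
  rw [r7] at m3
  rw [r1, r2] at s0 s0'
  rw [r3, r4] at s1 s1'
  rw [r5, r6] at s2 s2'
  have g : ∀ i, sdet (D q) (D (c i)) (D q') ≠ 0 := fun i => gp _ _ _ (eq i).ne (eq' i).ne' hqq
  have area : sdet (D q) (D (c 0)) (D (c 1)) + sdet (D q) (D (c 1)) (D (c 2))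
      + sdet (D q) (D (c 2)) (D (c 3)) + sdet (D q) (D (c 3)) (D (c 0))
      = sdet (D q') (D (c 0)) (D (c 1)) + sdet (D q') (D (c 1)) (D (c 2))
      + sdet (D q') (D (c 2)) (D (c 3)) + sdet (D q') (D (c 3)) (D (c 0)) := by
    simp only [sdet]; ring
  rcases mul_pos_iff.mp s0 with ⟨p0, p1⟩ | ⟨p0, p1⟩ <;>
    rcases mul_pos_iff.mp s1 with ⟨_, p2⟩ | ⟨_, p2⟩ <;>
    rcases mul_pos_iff.mp s2 with ⟨_, p3⟩ | ⟨_, p3⟩ <;>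
    rcases mul_pos_iff.mp s0' with ⟨p0', p1'⟩ | ⟨p0', p1'⟩ <;>
    rcases mul_pos_iff.mp s1' with ⟨_, p2'⟩ | ⟨_, p2'⟩ <;>
    rcases mul_pos_iff.mp s2' with ⟨_, p3'⟩ | ⟨_, p3'⟩ <;>
    first
    | (exfalso; linarith)
    | skip
  · rcases wheel_pos p0 p1 p2 p3 p0' p1' p2' p3' (g 0) (g 1) (g 2) (g 3) with h | h | h | h
    · exact m0 h
    · exact m1 h
    · exact m2 h
    · exact m3 h
  · have w := sdet_swap' (D q)
    have w' := sdet_swap' (D q')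
    rcases wheel_pos (q := D q) (q' := D q') (a1 := D (c 3)) (a2 := D (c 2)) (a3 := D (c 1))
      (a4 := D (c 0)) (by rw [w]; linarith) (by rw [w]; linarith) (by rw [w]; linarith)
      (by rw [w]; linarith) (by rw [w']; linarith) (by rw [w']; linarith) (by rw [w']; linarith)
      (by rw [w']; linarith) (g 3) (g 2) (g 1) (g 0) with h | h | h | h
    · exact m2 h.swap.rot
    · exact m1 h.swap.rot
    · exact m0 h.swap.rot
    · exact m3 h.swap.rot

/-- Two apexes cannot both see two 4-cycles. -/
theorem no_two_apex (gp : GenPos D) (nc : NoCross G S D) {z : Fin 2 → V} {c : Fin 2 → Fin 4 → V}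
    (hz : z 0 ≠ z 1)
    (hc : ∀ k l i j, c k i = c l j → k = l ∧ i = j) (ec : ∀ k i, G.Adj (c k i) (c k (i + 1)))
    (ez : ∀ m k i, G.Adj (z m) (c k i))
    (sz : ∀ m, z m ∈ S) (sc : ∀ k i, c k i ∈ S) : False := by
  have hz' : ∀ m : Fin 2, z (m + 1) ≠ z m := by
    intro m; fin_cases m
    · exact hz.symm
    · exact hz
  have dd : ∀ i : Fin 4, i + 2 ≠ i ∧ i + 2 ≠ i + 1 ∧ i + 3 ≠ i ∧ i + 3 ≠ i + 1 := by decide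
  have dm : ∀ m m' : Fin 2, m' = m ∨ m' = m + 1 := by decide
  -- everything in one triangle is in through the other apex
  have fwd : ∀ m k i l j, (c l j ≠ c k i) → (c l j ≠ c k (i + 1)) →
      InTri (D (z m)) (D (c k i)) (D (c k (i + 1))) (D (c l j)) →
      InTri (D (z m)) (D (c k i)) (D (c k (i + 1))) (D (z (m + 1))) := by
    intro m k i l j h1 h2 h
    exact sepV gp nc (ez m k i) (ec k i) (ez m k (i + 1)).symm (ez (m + 1) l j).symm
      ⟨sz _, sc _ _, sc _ _, sc _ _, sz _⟩ ⟨(ez _ _ _).ne', h1, h2⟩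
      ⟨hz' m, (ez _ _ _).ne, (ez _ _ _).ne⟩ h
  have bwd : ∀ m k i l j, (c l j ≠ c k i) → (c l j ≠ c k (i + 1)) →
      InTri (D (z m)) (D (c k i)) (D (c k (i + 1))) (D (z (m + 1))) →
      InTri (D (z m)) (D (c k i)) (D (c k (i + 1))) (D (c l j)) := by
    intro m k i l j h1 h2 h
    exact sepV gp nc (ez m k i) (ec k i) (ez m k (i + 1)).symm (ez (m + 1) l j)
      ⟨sz _, sc _ _, sc _ _, sz _, sc _ _⟩ ⟨hz' m, (ez _ _ _).ne, (ez _ _ _).ne⟩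
      ⟨(ez _ _ _).ne', h1, h2⟩ h
  have ex : ∃ k, ∀ m i, ¬ InTri (D (z m)) (D (c k i)) (D (c k (i + 1))) (D (z (m + 1))) := by
    by_contra hcon
    push Not at hcon
    obtain ⟨m, i, h⟩ := hcon 0
    obtain ⟨m', j, h'⟩ := hcon 1
    have ne : ∀ i j, c 0 i ≠ c 1 j := fun i j he => absurd (hc _ _ _ _ he).1 (by decide)
    refine no_mutual (q := D (z m)) (a := D (c 0 i)) (b := D (c 0 (i + 1))) (q' := D (z m'))
      (c := D (c 1 j)) (d := D (c 1 (j + 1))) ?_ (bwd _ _ _ _ _ (ne _ _).symm (ne _ _).symm h)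
      (bwd _ _ _ _ _ (ne _ _).symm (ne _ _).symm h) (bwd _ _ _ _ _ (ne _ _) (ne _ _) h')
    rcases dm m m' with rfl | rfl
    · exact Or.inr rfl
    · exact Or.inl h
  obtain ⟨k, hk⟩ := ex
  have inj : Function.Injective (c k) := fun i j h => (hc _ _ _ _ h).2
  refine no_wheel2 gp nc (q := z 0) (q' := z 1) (c := c k) hz inj (ec k) (ez 0 k) (ez 1 k)
    (sz 0) (sz 1) (sc k) ?_ ?_ ?_ ?_ (hk 0)
  · exact fun i h => hk 0 i (fwd _ _ _ _ _ (fun e => (dd i).1 (inj e)) (fun e => (dd i).2.1 (inj e)) h)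
  · exact fun i h => hk 0 i (fwd _ _ _ _ _ (fun e => (dd i).2.2.1 (inj e))
      (fun e => (dd i).2.2.2 (inj e)) h)
  · exact fun i h => hk 1 i (fwd _ _ _ _ _ (fun e => (dd i).1 (inj e)) (fun e => (dd i).2.1 (inj e)) h)
  · exact fun i h => hk 1 i (fwd _ _ _ _ _ (fun e => (dd i).2.2.1 (inj e))
      (fun e => (dd i).2.2.2 (inj e)) h)

/-- An edge vertex and the far edge of the cycle cannot both be outside the triangle. -/
theorem edge_vertex (gp : GenPos D) (nc : NoCross G S D) {q r x1 x2 x3 x4 : V}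
    (n13 : x1 ≠ x3) (n24 : x2 ≠ x4) (nr3 : r ≠ x3) (nr4 : r ≠ x4)
    (e12 : G.Adj x1 x2) (e23 : G.Adj x2 x3) (e34 : G.Adj x3 x4) (e41 : G.Adj x4 x1)
    (q1 : G.Adj q x1) (q2 : G.Adj q x2) (q3 : G.Adj q x3) (q4 : G.Adj q x4)
    (rq : G.Adj r q) (r1 : G.Adj r x1) (r2 : G.Adj r x2)
    (sq : q ∈ S) (sr : r ∈ S) (s1 : x1 ∈ S) (s2 : x2 ∈ S) (s3 : x3 ∈ S) (s4 : x4 ∈ S) :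
    InTri (D q) (D x1) (D x2) (D x3) ∨ InTri (D q) (D x1) (D x2) (D r) := by
  have k1 := rq.ne
  have k2 := r1.ne
  have k3 := r2.ne
  have k4 := q1.ne
  have k5 := q2.ne
  have k6 := q3.ne
  have k7 := q4.ne
  have k8 := e12.ne
  have k9 := e23.ne
  have k10 := e34.ne
  have k11 := e41.ne
  rcases k4_inside (q := D q) (a := D x1) (b := D x2) (r := D r)
    (gp _ _ _ k4 k2.symm k1.symm) (gp _ _ _ k8 k3.symm k2.symm) (gp _ _ _ k5.symm k1.symm k3.symm)
    (gp _ _ _ k4 k8 k5)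
    (nc _ _ _ _ rq e12 sr sq s1 s2 k2 k3 k4 k5)
    (nc _ _ _ _ r1 q2.symm sr s1 s2 sq k3 k1 k8 k4.symm)
    (nc _ _ _ _ r2 q1 sr s2 sq s1 k1 k2 k5.symm k8.symm) with h | h | h | h
  · exact Or.inr h
  · left
    have h3 : InTri (D x1) (D x2) (D r) (D x3) :=
      sepV gp nc e12 r2.symm r1 q3 (by refine ⟨?_, ?_, ?_, ?_, ?_⟩ <;> assumption)
          (by refine ⟨?_, ?_, ?_⟩ <;> first | assumption | (apply Ne.symm; assumption))
          (by refine ⟨?_, ?_, ?_⟩ <;> first | assumption | (apply Ne.symm; assumption)) h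
    rcases tri_split h h3 (gp _ _ _ k4 n13 k6) (gp _ _ _ k5 k9 k6) (gp _ _ _ k1.symm nr3 k6)
      with u | u | u
    · exact u.rot.rot
    · have u4 : InTri (D x2) (D r) (D q) (D x4) :=
        sepV gp nc r2.symm rq q2 e34 (by refine ⟨?_, ?_, ?_, ?_, ?_⟩ <;> assumption)
          (by refine ⟨?_, ?_, ?_⟩ <;> first | assumption | (apply Ne.symm; assumption))
          (by refine ⟨?_, ?_, ?_⟩ <;> first | assumption | (apply Ne.symm; assumption)) u
      have u1 : InTri (D x2) (D r) (D q) (D x1) :=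
        sepV gp nc r2.symm rq q2 e41 (by refine ⟨?_, ?_, ?_, ?_, ?_⟩ <;> assumption)
          (by refine ⟨?_, ?_, ?_⟩ <;> first | assumption | (apply Ne.symm; assumption))
          (by refine ⟨?_, ?_, ?_⟩ <;> first | assumption | (apply Ne.symm; assumption)) u4
      exact (tri_excl h.rot u1).elim
    · have u2 : InTri (D r) (D x1) (D q) (D x2) :=
        sepV gp nc r1 q1.symm rq.symm e23.symm (by refine ⟨?_, ?_, ?_, ?_, ?_⟩ <;> assumption)
          (by refine ⟨?_, ?_, ?_⟩ <;> first | assumption | (apply Ne.symm; assumption))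
          (by refine ⟨?_, ?_, ?_⟩ <;> first | assumption | (apply Ne.symm; assumption)) u
      exact (tri_excl h.rot.rot u2).elim
  · left
    have h4 : InTri (D x2) (D q) (D r) (D x4) :=
      sepV gp nc q2.symm rq.symm r2 e41.symm (by refine ⟨?_, ?_, ?_, ?_, ?_⟩ <;> assumption)
          (by refine ⟨?_, ?_, ?_⟩ <;> first | assumption | (apply Ne.symm; assumption))
          (by refine ⟨?_, ?_, ?_⟩ <;> first | assumption | (apply Ne.symm; assumption)) h
    rcases tri_split h h4 (gp _ _ _ k8 n24 k11.symm) (gp _ _ _ k4.symm k7 k11.symm)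
      (gp _ _ _ k2.symm nr4 k11.symm) with u | u | u
    · have u3 : InTri (D x2) (D q) (D x1) (D x3) :=
        sepV gp nc q2.symm q1 e12 e34.symm (by refine ⟨?_, ?_, ?_, ?_, ?_⟩ <;> assumption)
          (by refine ⟨?_, ?_, ?_⟩ <;> first | assumption | (apply Ne.symm; assumption))
          (by refine ⟨?_, ?_, ?_⟩ <;> first | assumption | (apply Ne.symm; assumption)) u
      exact u3.rot
    · have u3 : InTri (D q) (D r) (D x1) (D x3) :=
        sepV gp nc rq.symm r1 q1.symm e34.symm (by refine ⟨?_, ?_, ?_, ?_, ?_⟩ <;> assumption)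
          (by refine ⟨?_, ?_, ?_⟩ <;> first | assumption | (apply Ne.symm; assumption))
          (by refine ⟨?_, ?_, ?_⟩ <;> first | assumption | (apply Ne.symm; assumption)) u
      have u2 : InTri (D q) (D r) (D x1) (D x2) :=
        sepV gp nc rq.symm r1 q1.symm e23.symm (by refine ⟨?_, ?_, ?_, ?_, ?_⟩ <;> assumption)
          (by refine ⟨?_, ?_, ?_⟩ <;> first | assumption | (apply Ne.symm; assumption))
          (by refine ⟨?_, ?_, ?_⟩ <;> first | assumption | (apply Ne.symm; assumption)) u3
      exact (tri_excl h.rot u2).elim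
    · have u2 : InTri (D r) (D x2) (D x1) (D q) :=
        sepV gp nc r2 e12.symm r1.symm q4.symm (by refine ⟨?_, ?_, ?_, ?_, ?_⟩ <;> assumption)
          (by refine ⟨?_, ?_, ?_⟩ <;> first | assumption | (apply Ne.symm; assumption))
          (by refine ⟨?_, ?_, ?_⟩ <;> first | assumption | (apply Ne.symm; assumption)) u
      exact (tri_excl h.rot.rot u2).elim
  · left
    have h3 : InTri (D q) (D x1) (D r) (D x3) :=
      sepV gp nc q1 r1.symm rq e23 (by refine ⟨?_, ?_, ?_, ?_, ?_⟩ <;> assumption)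
          (by refine ⟨?_, ?_, ?_⟩ <;> first | assumption | (apply Ne.symm; assumption))
          (by refine ⟨?_, ?_, ?_⟩ <;> first | assumption | (apply Ne.symm; assumption)) h
    rcases tri_split h h3 (gp _ _ _ k5.symm k6 k9) (gp _ _ _ k8.symm n13 k9)
      (gp _ _ _ k3.symm nr3 k9) with u | u | u
    · exact u
    · have u2 : InTri (D x1) (D r) (D x2) (D q) :=
        sepV gp nc r1.symm r2 e12.symm q3.symm (by refine ⟨?_, ?_, ?_, ?_, ?_⟩ <;> assumption)
          (by refine ⟨?_, ?_, ?_⟩ <;> first | assumption | (apply Ne.symm; assumption))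
          (by refine ⟨?_, ?_, ?_⟩ <;> first | assumption | (apply Ne.symm; assumption)) u
      exact (tri_excl h.rot u2).elim
    · have u4 : InTri (D r) (D q) (D x2) (D x4) :=
        sepV gp nc rq q2 r2.symm e34 (by refine ⟨?_, ?_, ?_, ?_, ?_⟩ <;> assumption)
          (by refine ⟨?_, ?_, ?_⟩ <;> first | assumption | (apply Ne.symm; assumption))
          (by refine ⟨?_, ?_, ?_⟩ <;> first | assumption | (apply Ne.symm; assumption)) u
      have u1 : InTri (D r) (D q) (D x2) (D x1) :=
        sepV gp nc rq q2 r2.symm e41 (by refine ⟨?_, ?_, ?_, ?_, ?_⟩ <;> assumption)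
          (by refine ⟨?_, ?_, ?_⟩ <;> first | assumption | (apply Ne.symm; assumption))
          (by refine ⟨?_, ?_, ?_⟩ <;> first | assumption | (apply Ne.symm; assumption)) u4
      exact (tri_excl h.rot.rot u1).elim

end frames

/-! The graph G -/

/-- The three cycles of the graph. -/
def cyc : Fin 3 → Fin 4 → GVert
  | 0 => GVert.a
  | 1 => GVert.b
  | 2 => GVert.c

theorem cyc_inj {k l : Fin 3} {i j : Fin 4} (h : cyc k i = cyc l j) : k = l ∧ i = j := by
  fin_cases k <;> fin_cases l <;> simp_all [cyc]

theorem q_ne_cyc (i j k l) : GVert.q i j ≠ cyc k l := by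
  fin_cases k <;> simp [cyc]

theorem r_ne_cyc (i j k l) : GVert.r i j ≠ cyc k l := by
  fin_cases k <;> simp [cyc]

theorem adj_cyc (k i) : GraphG.Adj (cyc k i) (cyc k (i + 1)) := by
  have d : ∀ i : Fin 4, i ≠ i + 1 := by decide
  rw [GraphG, SimpleGraph.fromRel_adj]
  refine ⟨fun h => d i (cyc_inj h).2, Or.inl ?_⟩
  fin_cases k <;> simp [cyc, GRel]

theorem adj_q (i j k l) : GraphG.Adj (GVert.q i j) (cyc k l) := by
  rw [GraphG, SimpleGraph.fromRel_adj]
  refine ⟨q_ne_cyc _ _ _ _, Or.inl ?_⟩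
  fin_cases k <;> simp [cyc, GRel]

theorem adj_rq (i j) : GraphG.Adj (GVert.r i j) (GVert.q i j) := by
  rw [GraphG, SimpleGraph.fromRel_adj]
  exact ⟨by simp, Or.inl (by simp [GRel])⟩

theorem adj_r0 (i j k) : GraphG.Adj (GVert.r i j) (cyc k i) := by
  rw [GraphG, SimpleGraph.fromRel_adj]
  refine ⟨r_ne_cyc _ _ _ _, Or.inl ?_⟩
  fin_cases k <;> simp [cyc, GRel]

theorem adj_r1 (i j k) : GraphG.Adj (GVert.r i j) (cyc k (i + 1)) := by
  rw [GraphG, SimpleGraph.fromRel_adj]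
  refine ⟨r_ne_cyc _ _ _ _, Or.inl ?_⟩
  fin_cases k <;> simp [cyc, GRel]

/-- An explicit code of the vertices. -/
def gcode : GVert → Fin 5 × Fin 4 × Fin 2
  | .a i => (0, i, 0)
  | .b i => (1, i, 0)
  | .c i => (2, i, 0)
  | .q i j => (3, i, j)
  | .r i j => (4, i, j)

theorem finite_GVert : Finite GVert := by
  refine Finite.of_injective gcode ?_
  intro u v h
  cases u <;> cases v <;> simp_all [gcode]

/-- The far edge of cycle `k` lies inside the triangle of `q` over its edge `i`. -/
def GoodCyc (D : GVert → ℝ × ℝ) (q : GVert) (i : Fin 4) (k : Fin 3) : Prop :=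
  InTri (D q) (D (cyc k i)) (D (cyc k (i + 1))) (D (cyc k (i + 2))) ∧
  InTri (D q) (D (cyc k i)) (D (cyc k (i + 1))) (D (cyc k (i + 3)))

theorem fin4_facts : ∀ i : Fin 4, i ≠ i + 2 ∧ i + 1 ≠ i + 3 ∧ i + 1 + 1 = i + 2 ∧ i + 2 + 1 = i + 3 ∧
    i + 3 + 1 = i ∧ i ≠ i + 3 ∧ i + 1 ≠ i + 2 ∧ i + 2 + 2 = i ∧ i + 2 + 3 = i + 1 := by decide

theorem fin23 : ∀ i : Fin 4, i + 2 ≠ i + 3 := by decide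

theorem cycle_dich {D : GVert → ℝ × ℝ} {S : Set GVert} (gp : GenPos D) (nc : NoCross GraphG S D)
    (i : Fin 4) (j : Fin 2) (sq : GVert.q i j ∈ S) (sr : GVert.r i j ∈ S)
    (sc : ∀ k l, cyc k l ∈ S) (k : Fin 3) :
    GoodCyc D (GVert.q i j) i k ∨
      InTri (D (GVert.q i j)) (D (cyc k i)) (D (cyc k (i + 1))) (D (GVert.r i j)) := by
  obtain ⟨d1, d2, d3, d4, d5, d6, d7, d8, d9⟩ := fin4_facts i
  have e12 := adj_cyc k i
  have e23 : GraphG.Adj (cyc k (i + 1)) (cyc k (i + 2)) := by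
    have := adj_cyc k (i + 1); rwa [d3] at this
  have e34 : GraphG.Adj (cyc k (i + 2)) (cyc k (i + 3)) := by
    have := adj_cyc k (i + 2); rwa [d4] at this
  have e41 : GraphG.Adj (cyc k (i + 3)) (cyc k i) := by
    have := adj_cyc k (i + 3); rwa [d5] at this
  have n13 : cyc k i ≠ cyc k (i + 2) := fun h => d1 (cyc_inj h).2
  have n24 : cyc k (i + 1) ≠ cyc k (i + 3) := fun h => d2 (cyc_inj h).2
  rcases edge_vertex gp nc n13 n24 (r_ne_cyc i j _ _) (r_ne_cyc i j _ _) e12 e23 e34 e41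
    (adj_q i j _ _) (adj_q i j _ _) (adj_q i j _ _) (adj_q i j _ _) (adj_rq i j) (adj_r0 i j k)
    (adj_r1 i j k) sq sr (sc _ _) (sc _ _) (sc _ _) (sc _ _) with h | h
  · left
    exact ⟨h, sepV gp nc (adj_q i j _ _) e12 (adj_q i j _ _).symm e34
      ⟨sq, sc _ _, sc _ _, sc _ _, sc _ _⟩ ⟨(q_ne_cyc _ _ _ _).symm, n13.symm, e23.ne'⟩
      ⟨(q_ne_cyc _ _ _ _).symm, e41.ne, n24.symm⟩ h⟩
  · exact Or.inr h

theorem two_good {D : GVert → ℝ × ℝ} {S : Set GVert} (gp : GenPos D) (nc : NoCross GraphG S D)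
    (i : Fin 4) (j : Fin 2) (sq : GVert.q i j ∈ S) (sr : GVert.r i j ∈ S)
    (sc : ∀ k l, cyc k l ∈ S) (k l : Fin 3) (hkl : k ≠ l) :
    GoodCyc D (GVert.q i j) i k ∨ GoodCyc D (GVert.q i j) i l := by
  rcases cycle_dich gp nc i j sq sr sc k with h | h
  · exact Or.inl h
  rcases cycle_dich gp nc i j sq sr sc l with h' | h'
  · exact Or.inr h'
  exfalso
  have key : ∀ k l : Fin 3, k ≠ l → ∀ m, GraphG.Adj (GVert.r i j) (cyc l m) →
      InTri (D (GVert.q i j)) (D (cyc k i)) (D (cyc k (i + 1))) (D (GVert.r i j)) →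
      InTri (D (GVert.q i j)) (D (cyc k i)) (D (cyc k (i + 1))) (D (cyc l m)) := by
    intro k l hkl m hm h
    exact sepV gp nc (adj_q i j _ _) (adj_cyc k i) (adj_q i j _ _).symm hm
      ⟨sq, sc _ _, sc _ _, sr, sc _ _⟩ ⟨(adj_rq i j).ne, r_ne_cyc _ _ _ _, r_ne_cyc _ _ _ _⟩
      ⟨(q_ne_cyc _ _ _ _).symm, fun e => hkl (cyc_inj e).1.symm,
        fun e => hkl (cyc_inj e).1.symm⟩ h
  exact no_mutual (Or.inr rfl) (key k l hkl i (adj_r0 i j l) h)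
    (key k l hkl (i + 1) (adj_r1 i j l) h) (key l k hkl.symm i (adj_r0 i j k) h')

theorem good_pair {D : GVert → ℝ × ℝ} {S S' : Set GVert} (gp : GenPos D)
    (nc : NoCross GraphG S D) (nc' : NoCross GraphG S' D) (i : Fin 4) (j j' : Fin 2)
    (sq : GVert.q i j ∈ S) (sr : GVert.r i j ∈ S) (sc : ∀ k l, cyc k l ∈ S)
    (sq' : GVert.q (i + 2) j' ∈ S') (sr' : GVert.r (i + 2) j' ∈ S')
    (sc' : ∀ k l, cyc k l ∈ S') : False := by
  have t := two_good gp nc i j sq sr sc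
  have t' := two_good gp nc' (i + 2) j' sq' sr' sc'
  have both : ∃ k, GoodCyc D (GVert.q i j) i k ∧ GoodCyc D (GVert.q (i + 2) j') (i + 2) k := by
    have a1 := t 0 1 (by decide)
    have a2 := t 0 2 (by decide)
    have a3 := t 1 2 (by decide)
    have b1 := t' 0 1 (by decide)
    have b2 := t' 0 2 (by decide)
    have b3 := t' 1 2 (by decide)
    by_contra hcon
    have c0 := fun h h' => hcon ⟨0, h, h'⟩
    have c1 := fun h h' => hcon ⟨1, h, h'⟩
    have c2 := fun h h' => hcon ⟨2, h, h'⟩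
    clear hcon t t' nc nc' gp
    tauto
  obtain ⟨k, ⟨g1, g2⟩, g3, g4⟩ := both
  obtain ⟨d1, d2, d3, d4, d5, d6, d7, d8, d9⟩ := fin4_facts i
  rw [d4, d8] at g3
  rw [d4, d9] at g4
  have e23 : GraphG.Adj (cyc k (i + 1)) (cyc k (i + 2)) := by
    have := adj_cyc k (i + 1); rwa [d3] at this
  have e41 : GraphG.Adj (cyc k (i + 3)) (cyc k i) := by
    have := adj_cyc k (i + 3); rwa [d5] at this
  have ne : ∀ {m n : Fin 4}, m ≠ n → cyc k m ≠ cyc k n := fun h e => h (cyc_inj e).2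
  exact quad_contra g1 g2 g3 g4 (nc _ _ _ _ e23 e41 (sc _ _) (sc _ _) (sc _ _) (sc _ _)
    (ne d2) (adj_cyc k i).ne' (ne (fin23 i))
    (ne d1.symm))

/-! Time -/

/-- Helly property of finitely many intervals. -/
theorem common_time {V ι : Type*} [Finite ι] [Nonempty ι] (f : ι → V) {s e : V → ℕ}
    (h : ∀ i j, s (f i) ≤ e (f j)) :
    ∃ i0, ∀ i, s (f i) ≤ s (f i0) ∧ s (f i0) ≤ e (f i) := by
  obtain ⟨i0, h0⟩ := Finite.exists_max (fun i => s (f i))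
  exact ⟨i0, fun i => ⟨h0 i, h _ _⟩⟩

/-- The graph `G` does not admit a planar geometric storyplan. -/
theorem graphG_no_geom_storyplan : ¬ HasGeomStoryplan GraphG := by
  rintro ⟨len, s, e, D0, -, hI, hE, hF⟩
  have := finite_GVert
  obtain ⟨D, gp, hnc⟩ := perturb D0 (fun u v x y => GraphG.Adj u v ∧ GraphG.Adj x y ∧
    u ≠ x ∧ u ≠ y ∧ v ≠ x ∧ v ≠ y ∧ ∃ t, 1 ≤ t ∧ t ≤ len ∧ (s u ≤ t ∧ t ≤ e u) ∧
      (s v ≤ t ∧ t ≤ e v) ∧ (s x ≤ t ∧ t ≤ e x) ∧ (s y ≤ t ∧ t ≤ e y)) (by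
    rintro u v x y ⟨huv, hxy, h1, h2, h3, h4, t, ht, ht', a, b, c, d⟩
    rw [Set.disjoint_iff]
    intro p hp
    obtain ⟨z, hz, hz', -⟩ := (hF t ht ht').2.2 u v x y huv hxy a b c d
      (by rintro (⟨h, -⟩ | ⟨h, -⟩); exacts [h1 h, h2 h]) p hp
    rcases hz with rfl | rfl <;> rcases hz' with h | h
    exacts [h1 h, h2 h, h3 h, h4 h])
  have nc : ∀ t, 1 ≤ t → t ≤ len → NoCross GraphG {v | s v ≤ t ∧ t ≤ e v} D := by
    intro t ht ht' u v x y huv hxy a b c d h1 h2 h3 h4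
    exact hnc u v x y ⟨huv, hxy, h1, h2, h3, h4, t, ht, ht', a, b, c, d⟩
  have hA : ∀ {u v}, GraphG.Adj u v → s u ≤ e v := by
    intro u v h
    obtain ⟨t, h1, h2, h3, h4⟩ := hE u v h
    omega
  have hV : ∀ v, s v ≤ e v := fun v => (hI v).2.1
  have nc' : ∀ v, NoCross GraphG {w | s w ≤ s v ∧ s v ≤ e w} D := fun v =>
    nc _ (hI v).1 ((hI v).2.1.trans (hI v).2.2)
  -- all cycle vertices meet pairwise
  have hcyc : ∀ k i l j, s (cyc k i) ≤ e (cyc l j) := by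
    by_contra hcon
    push Not at hcon
    obtain ⟨k, i, l, j, hlt⟩ := hcon
    have hqq : ∀ m n m' n', s (GVert.q m n) ≤ e (GVert.q m' n') := by
      intro m n m' n'
      have h1 := hA (adj_q m n l j)
      have h2 := hA (adj_q m' n' k i).symm
      omega
    have hdiag : ∃ m : Fin 4, s (cyc 0 m) ≤ e (cyc 0 (m + 2)) ∧ s (cyc 0 (m + 2)) ≤ e (cyc 0 m) := by
      have e0 := adj_cyc 0 0
      have e1 := adj_cyc 0 1
      have e2 := adj_cyc 0 2
      have e3 := adj_cyc 0 3
      have r : (0 : Fin 4) + 1 = 1 ∧ (0 : Fin 4) + 2 = 2 ∧ (1 : Fin 4) + 1 = 2 ∧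
        (1 : Fin 4) + 2 = 3 ∧ (2 : Fin 4) + 1 = 3 ∧ (3 : Fin 4) + 1 = 0 := by decide
      obtain ⟨r1, r2, r3, r4, r5, r6⟩ := r
      rw [r1] at e0
      rw [r3] at e1
      rw [r5] at e2
      rw [r6] at e3
      have f0 := hA e0
      have f1 := hA e1
      have f2 := hA e2
      have f3 := hA e3
      have f0' := hA e0.symm
      have f1' := hA e1.symm
      have f2' := hA e2.symm
      have f3' := hA e3.symm
      by_contra hc
      push Not at hc
      have c0 := hc 0
      have c1 := hc 1
      rw [r2] at c0
      rw [r4] at c1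
      by_cases u : s (cyc 0 0) ≤ e (cyc 0 2)
      · have := c0 u
        by_cases w : s (cyc 0 1) ≤ e (cyc 0 3)
        · have := c1 w
          omega
        · omega
      · by_cases w : s (cyc 0 1) ≤ e (cyc 0 3)
        · have := c1 w
          omega
        · omega
    obtain ⟨m, hm1, hm2⟩ := hdiag
    obtain ⟨d1, -, d3, -, -, -, d7, -, -⟩ := fin4_facts m
    have e12 := adj_cyc 0 m
    have e23 : GraphG.Adj (cyc 0 (m + 1)) (cyc 0 (m + 2)) := by
      have := adj_cyc 0 (m + 1); rwa [d3] at this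
    let f : Fin 3 ⊕ Fin 4 → GVert := Sum.elim
      (fun x => match x with
        | 0 => cyc 0 m
        | 1 => cyc 0 (m + 1)
        | 2 => cyc 0 (m + 2)) (fun y => GVert.q y 0)
    obtain ⟨i0, h0⟩ := common_time f (s := s) (e := e) (by
      rintro (x | x) (y | y)
      · fin_cases x <;> fin_cases y
        · exact hV _
        · exact hA e12
        · exact hm1
        · exact hA e12.symm
        · exact hV _
        · exact hA e23
        · exact hm2
        · exact hA e23.symm
        · exact hV _
      · fin_cases x
        · exact hA (adj_q y 0 0 m).symm
        · exact hA (adj_q y 0 0 (m + 1)).symm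
        · exact hA (adj_q y 0 0 (m + 2)).symm
      · fin_cases y
        · exact hA (adj_q x 0 0 m)
        · exact hA (adj_q x 0 0 (m + 1))
        · exact hA (adj_q x 0 0 (m + 2))
      · exact hqq _ _ _ _)
    exact no_k34 gp (nc' (f i0)) (q := fun y => GVert.q y 0) (a1 := cyc 0 m)
      (a2 := cyc 0 (m + 1)) (a3 := cyc 0 (m + 2)) (fun x y h => by simpa using h) e12
      (fun h => d1 (cyc_inj h).2.symm) e23.ne' (fun _ => adj_q _ _ _ _) (fun _ => adj_q _ _ _ _)
      (fun _ => adj_q _ _ _ _) (h0 (Sum.inl 0)) (h0 (Sum.inl 1)) (h0 (Sum.inl 2))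
      (fun y => h0 (Sum.inr y))
  -- apexes are pairwise disjoint in time
  let qq : Fin 4 × Fin 2 → GVert := fun p => GVert.q p.1 p.2
  have qinj : ∀ p p', p ≠ p' → qq p ≠ qq p' := by
    intro p p' h h'
    simp only [qq, GVert.q.injEq] at h'
    exact h (Prod.ext h'.1 h'.2)
  have hdisj : ∀ p p', p ≠ p' → s (qq p) ≤ e (qq p') → e (qq p) < s (qq p') := by
    intro p p' hne h1
    by_contra h2
    push Not at h2
    let z : Fin 2 → GVert := fun m => match m with
      | 0 => qq p
      | 1 => qq p'
    let f : Fin 2 ⊕ (Fin 3 × Fin 4) → GVert := Sum.elim z (fun y => cyc y.1 y.2)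
    have az : ∀ m k i, GraphG.Adj (z m) (cyc k i) := by
      intro m k i
      fin_cases m
      · exact adj_q _ _ _ _
      · exact adj_q _ _ _ _
    obtain ⟨i0, h0⟩ := common_time f (s := s) (e := e) (by
      rintro (x | x) (y | y)
      · fin_cases x <;> fin_cases y
        · exact hV _
        · exact h1
        · exact h2
        · exact hV _
      · exact hA (az _ _ _)
      · exact hA (az _ _ _).symm
      · exact hcyc _ _ _ _)
    refine no_two_apex gp (nc' (f i0)) (z := z) (c := fun k i => cyc k.castSucc i)
      (qinj _ _ hne) ?_ (fun _ _ => adj_cyc _ _) (fun _ _ _ => az _ _ _)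
      (fun m => h0 (Sum.inl m)) (fun k i => h0 (Sum.inr (k.castSucc, i)))
    intro k l i j h
    have := cyc_inj h
    exact ⟨Fin.castSucc_injective _ this.1, this.2⟩
  obtain ⟨f, hf⟩ := Finite.exists_min (fun p => s (qq p))
  obtain ⟨l, hl⟩ := Finite.exists_max (fun p => s (qq p))
  have vis : ∀ i j, (i, j) ≠ f → (i, j) ≠ l → ∃ t, 1 ≤ t ∧ t ≤ len ∧
      GVert.q i j ∈ {v | s v ≤ t ∧ t ≤ e v} ∧ GVert.r i j ∈ {v | s v ≤ t ∧ t ≤ e v} ∧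
      ∀ k m, cyc k m ∈ {v | s v ≤ t ∧ t ≤ e v} := by
    intro i j h1 h2
    obtain ⟨t, t1, t2, t3, t4⟩ := hE _ _ (adj_rq i j)
    have g1 : e (qq f) < s (GVert.q i j) :=
      hdisj f (i, j) h1.symm ((hf (i, j)).trans (hV _))
    have g2 : e (GVert.q i j) < s (qq l) :=
      hdisj (i, j) l h2 ((hl (i, j)).trans (hV _))
    refine ⟨t, (hI _).1.trans t1, t2.trans (hI _).2.2, ⟨t3, t4⟩, ⟨t1, t2⟩, fun k m => ?_⟩
    have g3 := hA (adj_q f.1 f.2 k m).symm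
    have g4 := hA (adj_q l.1 l.2 k m)
    simp only [qq] at g1 g2
    constructor <;> omega
  have pig : ∀ f l : Fin 4 × Fin 2, ∃ (i : Fin 4) (j j' : Fin 2), (i, j) ≠ f ∧ (i, j) ≠ l ∧
      (i + 2, j') ≠ f ∧ (i + 2, j') ≠ l := by decide
  obtain ⟨i, j, j', p1, p2, p3, p4⟩ := pig f l
  obtain ⟨t, a1, a2, a3, a4, a5⟩ := vis i j p1 p2
  obtain ⟨t', b1, b2, b3, b4, b5⟩ := vis (i + 2) j' p3 p4
  exact good_pair gp (nc t a1 a2) (nc t' b1 b2) i j j' a3 a4 a5 b3 b4 b5
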